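/- Let p > 0 and α ≤ p. Then for every t ≥ 0, Ã(t) = (p/(p+1))·t·ã(t) − (α/(p+1)) · ∫₀^{ã(t)} s^{p+1} / ((log(e+s))^{α+1} (e+s)) ds. -/

import Mathlib

open Real Set

/-- a(t) = t^p / (log(e+t))^α. -/
noncomputable def a (p α t : ℝ) : ℝ := t ^ p / Real.log (Real.exp 1 + t) ^ α

/-- Ã(t) = ∫₀ᵗ ã(s) ds, where ã is a given function (intended as a⁻¹). -/
noncomputable def Atilde (atil : ℝ → ℝ) (t : ℝ) : ℝ := ∫ s in (0:ℝ)..t, atil s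

/-- The integrand of the correction term in the formula for the primitive of `a⁻¹`. -/
noncomputable def corr (p α s : ℝ) : ℝ :=
  s ^ (p + 1) / (Real.log (Real.exp 1 + s) ^ (α + 1) * (Real.exp 1 + s))

lemma one_le_log_exp_one_add {s : ℝ} (hs : 0 ≤ s) : 1 ≤ Real.log (Real.exp 1 + s) := by
  rw [Real.le_log_iff_exp_le (by positivity)]
  linarith

lemma a_zero {p : ℝ} (hp : 0 < p) (α : ℝ) : a p α 0 = 0 := by
  simp [a, Real.zero_rpow hp.ne']

lemma continuousOn_log_exp_one_add_rpow (β : ℝ) :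
    ContinuousOn (fun s : ℝ => Real.log (Real.exp 1 + s) ^ β) (Ici 0) := by
  refine ContinuousOn.rpow_const (ContinuousOn.log (by fun_prop) ?_) ?_
  · intro s hs
    have : (0 : ℝ) ≤ s := hs
    positivity
  · intro s hs
    exact Or.inl (by linarith [one_le_log_exp_one_add hs])

lemma log_exp_one_add_rpow_pos {s : ℝ} (hs : 0 ≤ s) (β : ℝ) :
    0 < Real.log (Real.exp 1 + s) ^ β :=
  Real.rpow_pos_of_pos (by linarith [one_le_log_exp_one_add hs]) _

lemma continuousOn_a {p : ℝ} (hp : 0 < p) (α : ℝ) : ContinuousOn (a p α) (Ici 0) :=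
  (continuousOn_id.rpow_const fun _ _ => Or.inr hp.le).div
    (continuousOn_log_exp_one_add_rpow α) fun _ hs => (log_exp_one_add_rpow_pos hs α).ne'

lemma continuousOn_corr {p : ℝ} (hp : 0 < p) (α : ℝ) : ContinuousOn (corr p α) (Ici 0) := by
  refine (continuousOn_id.rpow_const fun _ _ => Or.inr (by linarith)).div
    ((continuousOn_log_exp_one_add_rpow (α + 1)).mul (by fun_prop)) fun s hs => ?_
  have h0 : (0 : ℝ) ≤ s := hs
  have := log_exp_one_add_rpow_pos h0 (α + 1)
  positivity

lemma corr_eq {s : ℝ} (hs : 0 < s) (p α : ℝ) :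
    corr p α s = a p α s * (s / (Real.log (Real.exp 1 + s) * (Real.exp 1 + s))) := by
  have hL : 0 < Real.log (Real.exp 1 + s) := by linarith [one_le_log_exp_one_add hs.le]
  rw [corr, a, Real.rpow_add_one hs.ne', Real.rpow_add_one hL.ne', div_mul_div_comm, mul_assoc]

lemma hasDerivAt_a {s : ℝ} (hs : 0 < s) (p α : ℝ) :
    HasDerivAt (a p α) ((p * a p α s - α * corr p α s) / s) s := by
  have hL : 0 < Real.log (Real.exp 1 + s) := by linarith [one_le_log_exp_one_add hs.le]
  have hE : 0 < Real.exp 1 + s := by positivity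
  have hLα := Real.rpow_pos_of_pos hL α
  have h1 : HasDerivAt (fun x : ℝ => x ^ p) (p * s ^ (p - 1)) s :=
    Real.hasDerivAt_rpow_const (Or.inl hs.ne')
  have h2 : HasDerivAt (fun x : ℝ => Real.log (Real.exp 1 + x) ^ α) _ s :=
    (((hasDerivAt_id s).const_add (Real.exp 1)).log hE.ne').rpow_const (p := α) (Or.inl hL.ne')
  refine (h1.div h2 hLα.ne').congr_deriv ?_
  simp only [id]
  rw [corr_eq hs, a, Real.rpow_sub_one hs.ne', Real.rpow_sub_one hL.ne']
  field_simp

lemma deriv_a_pos {p α s : ℝ} (hp : 0 < p) (hα : α ≤ p) (hs : 0 < s) :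
    0 < (p * a p α s - α * corr p α s) / s := by
  have hL := one_le_log_exp_one_add hs.le
  have hE : 0 < Real.exp 1 := Real.exp_pos 1
  have ha : 0 < a p α s := div_pos (Real.rpow_pos_of_pos hs p) (log_exp_one_add_rpow_pos hs.le α)
  set r := s / (Real.log (Real.exp 1 + s) * (Real.exp 1 + s)) with hr
  have hr0 : 0 ≤ r := by positivity
  have hr1 : r < 1 := by
    rw [hr, div_lt_one (by positivity)]
    nlinarith
  have hαr : α * r < p := by
    rcases le_or_gt α 0 with h | h
    · nlinarith
    · nlinarith
  rw [corr_eq hs, ← hr]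
  refine div_pos ?_ hs
  nlinarith

lemma strictMonoOn_a {p α : ℝ} (hp : 0 < p) (hα : α ≤ p) : StrictMonoOn (a p α) (Ici 0) := by
  refine strictMonoOn_of_deriv_pos (convex_Ici 0) (continuousOn_a hp α) fun s hs => ?_
  rw [interior_Ici] at hs
  rw [(hasDerivAt_a hs p α).deriv]
  exact deriv_a_pos hp hα hs

lemma image_a_Ioc {p α x : ℝ} (hp : 0 < p) (hα : α ≤ p) (hx : 0 ≤ x) :
    a p α '' Ioc 0 x = Ioc 0 (a p α x) := by
  have hmono := strictMonoOn_a hp hα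
  refine Subset.antisymm ?_ ?_
  · rintro _ ⟨s, hs, rfl⟩
    refine ⟨?_, hmono.monotoneOn hs.1.le hx hs.2⟩
    simpa [a_zero hp] using hmono self_mem_Ici hs.1.le hs.1
  · simpa [a_zero hp] using
      intermediate_value_Ioc hx ((continuousOn_a hp α).mono Icc_subset_Ici_self)

lemma integral_mul_deriv_a {p : ℝ} (hp : 0 < p) (α : ℝ) {x : ℝ} (hx : 0 ≤ x) :
    ∫ s in (0:ℝ)..x, (p * a p α s - α * corr p α s) =
      p / (p + 1) * (a p α x * x) - α / (p + 1) * ∫ s in (0:ℝ)..x, corr p α s := by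
  have hca : ContinuousOn (a p α) (uIcc 0 x) :=
    (continuousOn_a hp α).mono (by rw [uIcc_of_le hx]; exact Icc_subset_Ici_self)
  have hcc : ContinuousOn (corr p α) (uIcc 0 x) :=
    (continuousOn_corr hp α).mono (by rw [uIcc_of_le hx]; exact Icc_subset_Ici_self)
  have hia := hca.intervalIntegrable (μ := MeasureTheory.volume)
  have hic := hcc.intervalIntegrable (μ := MeasureTheory.volume)
  have key : ∫ s in (0:ℝ)..x, ((p + 1) * a p α s - α * corr p α s) = a p α x * x - a p α 0 * 0 := by
    refine intervalIntegral.integral_eq_sub_of_hasDerivAt_of_le (f := fun s => a p α s * s) hx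
      ((hca.mul continuousOn_id).mono (by rw [uIcc_of_le hx])) (fun s hs => ?_)
      ((hia.const_mul _).sub (hic.const_mul _))
    have hs0 : s ≠ 0 := hs.1.ne'
    refine ((hasDerivAt_a hs.1 p α).mul (hasDerivAt_id s)).congr_deriv ?_
    simp only [id]
    field_simp
    ring
  rw [intervalIntegral.integral_sub (hia.const_mul _) (hic.const_mul _),
    intervalIntegral.integral_const_mul, intervalIntegral.integral_const_mul] at key ⊢
  have hp1 : p + 1 ≠ 0 := by positivity
  field_simp
  linear_combination p * key

/-- For p > 0 and α ≤ p, for every t ≥ 0,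
Ã(t) = (p/(p+1))·t·ã(t) − (α/(p+1)) ∫₀^{ã(t)} s^{p+1}/((log(e+s))^{α+1}(e+s)) ds. -/
theorem Atilde_formula (p α : ℝ) (hp : 0 < p) (hα : α ≤ p)
    (atil : ℝ → ℝ) (hmaps : Set.MapsTo atil (Set.Ici 0) (Set.Ici 0))
    (hinv : Set.InvOn atil (a p α) (Set.Ici 0) (Set.Ici 0)) :
    ∀ t : ℝ, 0 ≤ t →
      Atilde atil t =
        (p / (p + 1)) * (t * atil t) -
          (α / (p + 1)) *
            ∫ s in (0:ℝ)..(atil t),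
              s ^ (p + 1) / (Real.log (Real.exp 1 + s) ^ (α + 1) * (Real.exp 1 + s)) := by
  intro t ht
  obtain ⟨hleft, hright⟩ := hinv
  have hx : 0 ≤ atil t := hmaps ht
  have hat : a p α (atil t) = t := hright ht
  have hcov := MeasureTheory.integral_image_eq_integral_abs_deriv_smul (measurableSet_Ioc)
    (fun s (hs : s ∈ Ioc 0 (atil t)) => (hasDerivAt_a hs.1 p α).hasDerivWithinAt)
    (hleft.injOn.mono fun s hs => hs.1.le) atil
  rw [image_a_Ioc hp hα hx, hat, ← intervalIntegral.integral_of_le ht] at hcov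
  have hparts := integral_mul_deriv_a hp α hx
  rw [hat] at hparts
  refine hcov.trans (Eq.trans ?_ hparts)
  rw [intervalIntegral.integral_of_le hx]
  refine MeasureTheory.setIntegral_congr_fun measurableSet_Ioc fun s hs => ?_
  have hs0 : s ≠ 0 := hs.1.ne'
  have hs' : atil (a p α s) = s := hleft hs.1.le
  simp only [hs', abs_of_pos (deriv_a_pos hp hα hs.1), smul_eq_mul]
  field_simp
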